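/- Let ω be the Cantor measure on [0,1], fix 0 < δ < 1/2, choose for each k ≥ 0 and 1 ≤ j ≤ 2^k a point z_j^k ∈ G_j^k whose distance to each endpoint of G_j^k is at least δ·|G_j^k|, and let σ = Σ_{k≥0} Σ_{j=1}^{2^k} (2/9)^k δ_{z_j^k}. Let M denote the Hardy–Littlewood maximal operator on measures, Mν(x) = sup { ν(I)/|I| : I a bounded interval with x ∈ I }. Then there is a constant C (depending only on δ) such that for every bounded interval Q, ∫_ℝ M(1_Q σ)(x)² dω(x) ≤ C·σ(Q), where 1_Q σ is the restriction of σ to Q. -/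

import Mathlib

open MeasureTheory Set ENNReal

/-- The left endpoint of the generation-`k` triadic interval of the middle-thirds Cantor
construction determined by the digits `d`. -/
noncomputable def cantorLeft (k : ℕ) (d : Fin k → Bool) : ℝ :=
  ∑ i : Fin k, (cond (d i) 2 0) / 3 ^ ((i : ℕ) + 1)

/-- The generation-`k` closed triadic interval `I_d^k`, of length `3^{-k}`. -/
noncomputable def cantorI (k : ℕ) (d : Fin k → Bool) : Set ℝ :=
  Set.Icc (cantorLeft k d) (cantorLeft k d + (1/3) ^ k)

/-- The left endpoint of the removed open middle third `G_d^k` of `I_d^k`. -/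
noncomputable def gLeft (k : ℕ) (d : Fin k → Bool) : ℝ :=
  cantorLeft k d + (1/3) ^ (k + 1)

/-- The right endpoint of the removed open middle third `G_d^k` of `I_d^k`. -/
noncomputable def gRight (k : ℕ) (d : Fin k → Bool) : ℝ :=
  cantorLeft k d + 2 * (1/3) ^ (k + 1)

/-- `ω` is the Cantor measure on `[0,1]`: the unique Borel probability measure with
`ω(I_d^k) = 2^{-k}` for every `k ≥ 0` and every generation-`k` triadic interval. -/
def IsCantorMeasure (ω : Measure ℝ) : Prop :=
  IsProbabilityMeasure ω ∧
  ∀ (k : ℕ) (d : Fin k → Bool), ω (cantorI k d) = (1/2 : ℝ≥0∞) ^ k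

/-- The points `z_d^k ∈ G_d^k` lie at distance at least `δ·|G_d^k|` from both endpoints of
`G_d^k` (recall `|G_d^k| = 3^{-(k+1)}`). -/
def GoodPoints (δ : ℝ) (z : (k : ℕ) → (Fin k → Bool) → ℝ) : Prop :=
  ∀ (k : ℕ) (d : Fin k → Bool),
    gLeft k d + δ * (1/3) ^ (k + 1) ≤ z k d ∧ z k d ≤ gRight k d - δ * (1/3) ^ (k + 1)

/-- The measure `σ = Σ_{k,d} (2/9)^k δ_{z_d^k}`. -/
noncomputable def cantorSigma (z : (k : ℕ) → (Fin k → Bool) → ℝ) : Measure ℝ :=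
  Measure.sum fun p : Σ k : ℕ, Fin k → Bool =>
    ((2:ℝ≥0∞)/9) ^ p.1 • Measure.dirac (z p.1 p.2)

/-- The Hardy–Littlewood maximal function of a measure:
`Mν(x) = sup {ν(I)/|I| : I a bounded interval containing x}`. -/
noncomputable def maxFn (ν : Measure ℝ) (x : ℝ) : ℝ≥0∞ :=
  ⨆ (a : ℝ) (b : ℝ) (_ : a < b) (_ : x ∈ Set.Icc a b),
    ν (Set.Icc a b) / ENNReal.ofReal (b - a)

/-- Left endpoint of the generation-`k` interval given by the first `k` terms of `t`. -/
noncomputable def prefixLeft (k : ℕ) (t : ℕ → Bool) : ℝ :=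
  cantorLeft k fun i => t i

/-- An infinite digit sequence extending `d`. -/
def extendDigits {k : ℕ} (d : Fin k → Bool) (n : ℕ) : Bool :=
  if h : n < k then d ⟨n, h⟩ else false

lemma measurableSet_cantorI (k : ℕ) (d : Fin k → Bool) : MeasurableSet (cantorI k d) :=
  measurableSet_Icc

lemma extendDigits_val {k : ℕ} (d : Fin k → Bool) : (fun i : Fin k => extendDigits d i) = d := by
  funext i
  simp [extendDigits]

lemma prefixLeft_succ (k : ℕ) (t : ℕ → Bool) :
    prefixLeft (k + 1) t = prefixLeft k t + (cond (t k) 2 0) * (1/3) ^ (k + 1) := by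
  simp [prefixLeft, cantorLeft, Fin.sum_univ_castSucc, div_eq_mul_inv]

lemma prefixLeft_congr {m : ℕ} {s t : ℕ → Bool} (h : ∀ i < m, s i = t i) :
    prefixLeft m s = prefixLeft m t := by
  unfold prefixLeft
  congr 1
  funext i
  exact h i i.2

lemma prefixLeft_mono {m n : ℕ} (h : m ≤ n) (t : ℕ → Bool) :
    prefixLeft m t ≤ prefixLeft n t := by
  refine monotone_nat_of_le_succ (f := fun n => prefixLeft n t) (fun n => ?_) h
  have : (0 : ℝ) ≤ (cond (t n) 2 0) * (1/3) ^ (n + 1) := by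
    cases t n <;> simp
  simp only [prefixLeft_succ]
  linarith

lemma prefixRight_anti {m n : ℕ} (h : m ≤ n) (t : ℕ → Bool) :
    prefixLeft n t + (1/3) ^ n ≤ prefixLeft m t + (1/3) ^ m := by
  refine antitone_nat_of_succ_le (f := fun n => prefixLeft n t + (1/3 : ℝ) ^ n) (fun n => ?_) h
  have hp : (0 : ℝ) < (1/3) ^ n := by positivity
  simp only [prefixLeft_succ, pow_succ]
  cases t n <;> simp only [cond_true, cond_false] <;> linarith

lemma cantorI_subset {m n : ℕ} (h : m ≤ n) (t : ℕ → Bool) :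
    cantorI n (fun i => t i) ⊆ cantorI m (fun i => t i) :=
  Icc_subset_Icc (prefixLeft_mono h t) (prefixRight_anti h t)

lemma cantorI_congr {m : ℕ} {s t : ℕ → Bool} (h : ∀ i < m, s i = t i) :
    cantorI m (fun i => s i) = cantorI m (fun i => t i) := by
  have : (fun i : Fin m => s i) = fun i : Fin m => t i := funext fun i => h i i.2
  rw [this]

lemma le_of_digit_false {m n : ℕ} (h : m < n) {t : ℕ → Bool} (ht : t m = false) {x : ℝ}
    (hx : x ∈ cantorI n fun i => t i) : x ≤ prefixLeft m t + (1/3) ^ (m + 1) := by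
  have := (cantorI_subset (Nat.succ_le_of_lt h) t hx).2
  change x ≤ prefixLeft (m + 1) t + _ at this
  rw [prefixLeft_succ, ht] at this
  simpa using this

lemma le_of_digit_true {m n : ℕ} (h : m < n) {t : ℕ → Bool} (ht : t m = true) {x : ℝ}
    (hx : x ∈ cantorI n fun i => t i) : prefixLeft m t + 2 * (1/3) ^ (m + 1) ≤ x := by
  have := (cantorI_subset (Nat.succ_le_of_lt h) t hx).1
  change prefixLeft (m + 1) t ≤ x at this
  rw [prefixLeft_succ, ht] at this
  simpa using this

lemma agree_or_exists_first_ne (s t : ℕ → Bool) (n : ℕ) :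
    (∀ i < n, s i = t i) ∨ ∃ m < n, (∀ i < m, s i = t i) ∧ s m ≠ t m := by
  classical
  by_cases h : ∃ m, m < n ∧ s m ≠ t m
  · refine Or.inr ⟨Nat.find h, (Nat.find_spec h).1, fun i hi => ?_, (Nat.find_spec h).2⟩
    by_contra hne
    exact Nat.find_min h hi ⟨hi.trans (Nat.find_spec h).1, hne⟩
  · push Not at h
    exact Or.inl h

lemma GoodPoints.mem_cantorI {δ : ℝ} (hδ : 0 < δ) {z : (k : ℕ) → (Fin k → Bool) → ℝ}
    (hz : GoodPoints δ z) (k : ℕ) (d : Fin k → Bool) : z k d ∈ cantorI k d := by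
  obtain ⟨h1, h2⟩ := hz k d
  have hp : (0 : ℝ) < (1/3) ^ k := by positivity
  have hq : (0 : ℝ) < δ * (1/3) ^ (k + 1) := by positivity
  simp only [gLeft, gRight, pow_succ] at *
  constructor <;> linarith

/-- Points of intervals with different addresses are separated by the gap at the first digit where
the addresses differ. -/
lemma GoodPoints.separated {δ : ℝ} (hδ : 0 < δ) {z : (k : ℕ) → (Fin k → Bool) → ℝ}
    (hz : GoodPoints δ z) {m n l : ℕ} (hn : m < n) (hl : m < l) {s t : ℕ → Bool}
    (h : ∀ i < m, s i = t i) (hne : s m ≠ t m) {x y : ℝ}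
    (hx : x ∈ cantorI n fun i => s i) (hy : y ∈ cantorI l fun i => t i) :
    z m (fun i => s i) ∈ uIcc x y ∧ (1/3) ^ (m + 1) ≤ |x - y| := by
  obtain ⟨h1, h2⟩ := hz m (fun i => s i)
  have hc := prefixLeft_congr h
  have hp : (0 : ℝ) < (1/3) ^ (m + 1) := by positivity
  have hq : (0 : ℝ) < δ * (1/3) ^ (m + 1) := by positivity
  change prefixLeft m s + _ + _ ≤ _ at h1
  change _ ≤ prefixLeft m s + _ - _ at h2
  cases hs : s m <;> cases ht : t m
  · simp [hs, ht] at hne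
  · have := le_of_digit_false hn hs hx
    have := le_of_digit_true hl ht hy
    refine ⟨mem_uIcc.2 (Or.inl ⟨by linarith, by linarith⟩), ?_⟩
    rw [abs_sub_comm]
    exact le_trans (by linarith) (le_abs_self _)
  · have := le_of_digit_true hn hs hx
    have := le_of_digit_false hl ht hy
    exact ⟨mem_uIcc.2 (Or.inr ⟨by linarith, by linarith⟩),
      le_trans (by linarith) (le_abs_self _)⟩
  · simp [hs, ht] at hne

lemma GoodPoints.disjoint_cantorI {δ : ℝ} (hδ : 0 < δ) {z : (k : ℕ) → (Fin k → Bool) → ℝ}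
    (hz : GoodPoints δ z) (n : ℕ) :
    Pairwise (Function.onFun Disjoint fun d : Fin n → Bool => cantorI n d) := by
  intro d e hde
  rw [Function.onFun, Set.disjoint_left]
  intro x hx hy
  rw [← extendDigits_val d] at hx
  rw [← extendDigits_val e] at hy
  rcases agree_or_exists_first_ne (extendDigits d) (extendDigits e) n with h | ⟨m, hm, h, hne⟩
  · refine hde ?_
    rw [← extendDigits_val d, ← extendDigits_val e]
    exact funext fun i => h i i.2
  · have := (hz.separated hδ hm hm h hne hx hy).2
    have hp : (0 : ℝ) < (1/3) ^ (m + 1) := by positivity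
    rw [sub_self, abs_zero] at this
    linarith

lemma GoodPoints.ae_mem {δ : ℝ} (hδ : 0 < δ) {z : (k : ℕ) → (Fin k → Bool) → ℝ}
    (hz : GoodPoints δ z) {ω : Measure ℝ} (hω : IsCantorMeasure ω) :
    ∀ᵐ x ∂ω, ∀ n, ∃ d : Fin n → Bool, x ∈ cantorI n d := by
  have := hω.1
  rw [ae_all_iff]
  intro n
  have hU : ω (⋃ d : Fin n → Bool, cantorI n d) = 1 := by
    rw [measure_iUnion (hz.disjoint_cantorI hδ n) (measurableSet_cantorI n)]
    simp only [hω.2, tsum_fintype, Finset.sum_const, Finset.card_univ, Fintype.card_fun,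
      Fintype.card_bool, Fintype.card_fin, nsmul_eq_mul, Nat.cast_pow, Nat.cast_ofNat]
    rw [← mul_pow, one_div, ENNReal.mul_inv_cancel (by simp) (by simp), one_pow]
  have hmeas : MeasurableSet (⋃ d : Fin n → Bool, cantorI n d) :=
    MeasurableSet.iUnion (measurableSet_cantorI n)
  filter_upwards [(mem_ae_iff_prob_eq_one hmeas).2 hU] with x hx
  exact mem_iUnion.1 hx

/-- The point of least generation in an order-connected set is an ancestor of all the others. -/
lemma GoodPoints.agree_of_minimal {δ : ℝ} (hδ : 0 < δ) {z : (k : ℕ) → (Fin k → Bool) → ℝ}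
    (hz : GoodPoints δ z) {a b : ℝ} {k : ℕ} {s : ℕ → Bool}
    (hs : z k (fun i => s i) ∈ Icc a b) (hmin : ∀ l (e : Fin l → Bool), z l e ∈ Icc a b → k ≤ l)
    {l : ℕ} {t : ℕ → Bool} (ht : z l (fun i => t i) ∈ Icc a b) : ∀ i < k, s i = t i := by
  rcases agree_or_exists_first_ne s t k with h | ⟨m, hm, h, hne⟩
  · exact h
  · have hk := hmin _ _ ht
    have := (hz.separated hδ hm (hm.trans_le hk) h hne (hz.mem_cantorI hδ k fun i => s i)
      (hz.mem_cantorI hδ l fun i => t i)).1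
    have := hmin _ _ (uIcc_subset_Icc hs ht this)
    omega

lemma exists_minimal_point (z : (k : ℕ) → (Fin k → Bool) → ℝ) (a b : ℝ) :
    (∀ l (e : Fin l → Bool), z l e ∉ Icc a b) ∨
    ∃ (k : ℕ) (s : ℕ → Bool), z k (fun i => s i) ∈ Icc a b ∧
      ∀ l (e : Fin l → Bool), z l e ∈ Icc a b → k ≤ l := by
  classical
  by_cases h : ∃ l, ∃ e : Fin l → Bool, z l e ∈ Icc a b
  · obtain ⟨d, hd⟩ := Nat.find_spec h
    refine Or.inr ⟨Nat.find h, extendDigits d, ?_, fun l e he => Nat.find_min' h ⟨e, he⟩⟩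
    rwa [extendDigits_val]
  · push Not at h
    exact Or.inl h

lemma cantorSigma_apply (z : (k : ℕ) → (Fin k → Bool) → ℝ) {A : Set ℝ} (hA : MeasurableSet A) :
    cantorSigma z A =
      ∑' (l : ℕ) (e : Fin l → Bool), ((2:ℝ≥0∞)/9) ^ l * A.indicator 1 (z l e) := by
  rw [cantorSigma, Measure.sum_apply _ hA, ENNReal.tsum_sigma']
  simp [Measure.dirac_apply' _ hA]

lemma cantorSigma_eq_zero {z : (k : ℕ) → (Fin k → Bool) → ℝ} {a b : ℝ}
    (h : ∀ l (e : Fin l → Bool), z l e ∉ Icc a b) : cantorSigma z (Icc a b) = 0 := by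
  rw [cantorSigma_apply z measurableSet_Icc]
  simp only [indicator_of_notMem (h _ _), mul_zero, tsum_zero]

lemma le_cantorSigma {z : (k : ℕ) → (Fin k → Bool) → ℝ} {a b : ℝ} {k : ℕ} {d : Fin k → Bool}
    (h : z k d ∈ Icc a b) : ((2:ℝ≥0∞)/9) ^ k ≤ cantorSigma z (Icc a b) := by
  rw [cantorSigma_apply z measurableSet_Icc]
  refine le_trans ?_ (ENNReal.le_tsum k)
  refine le_trans ?_ (ENNReal.le_tsum d)
  simp [indicator_of_mem h]

lemma card_agree_le (k j : ℕ) (s : ℕ → Bool) :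
    (Finset.univ.filter fun e : Fin (k + j) → Bool =>
      ∀ i < k, s i = extendDigits e i).card ≤ 2 ^ j := by
  have hc : (Finset.univ : Finset (Fin j → Bool)).card = 2 ^ j := by simp
  rw [← hc]
  refine Finset.card_le_card_of_injOn (fun e i => e (Fin.natAdd k i)) (fun _ _ => by simp) ?_
  intro e he f hf hef
  simp only [Finset.coe_filter, Finset.mem_univ, true_and, mem_ofPred_eq] at he hf
  funext i
  refine Fin.addCases (fun i => ?_) (fun i => congrFun hef i) i
  have := (he i i.2).symm.trans (hf i i.2)
  have hi : (i : ℕ) < k + j := by omega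
  simp only [extendDigits, hi, dif_pos] at this
  exact this

lemma tsum_two_ninths_le (k : ℕ) :
    ∑' j : ℕ, ((2:ℝ≥0∞)/9) ^ (k + j) * 2 ^ j ≤ 2 * (2/9) ^ k := by
  have h (j : ℕ) : ((2:ℝ≥0∞)/9) ^ (k + j) * 2 ^ j ≤ (2/9) ^ k * 2⁻¹ ^ j := by
    rw [pow_add, mul_assoc, ← mul_pow]
    gcongr
    rw [← ENNReal.toReal_le_toReal (by finiteness) (by finiteness)]
    simp only [toReal_mul, toReal_div, toReal_inv, toReal_ofNat]
    norm_num
  refine (ENNReal.tsum_le_tsum h).trans ?_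
  rw [ENNReal.tsum_mul_left, ENNReal.tsum_geometric, ENNReal.one_sub_inv_two, inv_inv, mul_comm]

lemma GoodPoints.cantorSigma_le {δ : ℝ} (hδ : 0 < δ) {z : (k : ℕ) → (Fin k → Bool) → ℝ}
    (hz : GoodPoints δ z) {a b : ℝ} {k : ℕ} {s : ℕ → Bool}
    (hs : z k (fun i => s i) ∈ Icc a b)
    (hmin : ∀ l (e : Fin l → Bool), z l e ∈ Icc a b → k ≤ l) :
    cantorSigma z (Icc a b) ≤ 2 * (2/9) ^ k := by
  classical
  rw [cantorSigma_apply z measurableSet_Icc, ← ENNReal.summable.sum_add_tsum_nat_add' (k := k)]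
  rw [Finset.sum_eq_zero, zero_add]
  · refine le_trans (ENNReal.tsum_le_tsum fun j => ?_) (tsum_two_ninths_le k)
    rw [add_comm j k, ENNReal.tsum_mul_left]
    gcongr
    calc ∑' e : Fin (k + j) → Bool, (Icc a b).indicator 1 (z (k + j) e)
        ≤ ∑ e : Fin (k + j) → Bool, if ∀ i < k, s i = extendDigits e i then (1 : ℝ≥0∞) else 0 := by
          rw [tsum_fintype]
          refine Finset.sum_le_sum fun e _ => ?_
          by_cases he : z (k + j) e ∈ Icc a b
          · rw [if_pos, indicator_of_mem he, Pi.one_apply]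
            rw [← extendDigits_val e] at he
            exact hz.agree_of_minimal hδ hs hmin he
          · simp [indicator_of_notMem he]
      _ ≤ 2 ^ j := by
          rw [Finset.sum_boole]
          exact_mod_cast card_agree_le k j s
  · intro l hl
    have hl' : ∀ e : Fin l → Bool, z l e ∉ Icc a b := fun e he => by
      have := hmin l e he
      have := Finset.mem_range.1 hl
      omega
    simp only [indicator_of_notMem (hl' _), mul_zero, tsum_zero]

/-- A point of the Cantor set lies at distance `≳ 3^{-m}` from `z_t^n`, where `m` is the length of
the common part of the addresses. -/
lemma GoodPoints.exists_common {δ : ℝ} (hδ : 0 < δ) (hδ1 : δ ≤ 1)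
    {z : (k : ℕ) → (Fin k → Bool) → ℝ} (hz : GoodPoints δ z) {x : ℝ} {n : ℕ}
    {e : Fin (n + 1) → Bool} (hx : x ∈ cantorI (n + 1) e) (t : ℕ → Bool) :
    ∃ m ≤ n, x ∈ cantorI m (fun i => t i) ∧
      δ * (1/3) ^ (m + 1) ≤ |x - z n fun i => t i| := by
  rw [← extendDigits_val e] at hx
  set s := extendDigits e
  rcases agree_or_exists_first_ne s t n with h | ⟨m, hm, h, hne⟩
  · refine ⟨n, le_rfl, cantorI_congr h ▸ cantorI_subset n.le_succ s hx, ?_⟩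
    obtain ⟨h1, h2⟩ := hz n (fun i => t i)
    change prefixLeft n t + _ + _ ≤ _ at h1
    change _ ≤ prefixLeft n t + _ - _ at h2
    rw [← prefixLeft_congr h] at h1 h2
    cases hs : s n
    · have := le_of_digit_false n.lt_succ_self hs hx
      rw [abs_sub_comm]
      exact le_trans (by linarith) (le_abs_self _)
    · have := le_of_digit_true n.lt_succ_self hs hx
      exact le_trans (by linarith) (le_abs_self _)
  · refine ⟨m, hm.le, cantorI_congr h ▸ cantorI_subset (by omega) s hx, ?_⟩
    refine le_trans ?_ (hz.separated hδ (hm.trans n.lt_succ_self) hm h hne hx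
      (hz.mem_cantorI hδ n fun i => t i)).2
    exact mul_le_of_le_one_left (by positivity) hδ1

lemma two_ninths_pow_mul_le {k n m : ℕ} (hkn : k ≤ n) (hmn : m ≤ n) :
    (2/9 : ℝ) ^ n * 3 ^ m ≤ (2/9) ^ k * 3 ^ min m k := by
  rcases le_total m k with h | h
  · rw [min_eq_left h]
    gcongr ?_ * _
    exact pow_le_pow_of_le_one (by norm_num) (by norm_num) hkn
  · rw [min_eq_right h]
    calc (2/9 : ℝ) ^ n * 3 ^ m ≤ (2/9) ^ n * 3 ^ n := by gcongr; norm_num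
      _ = (2/3) ^ n := by rw [← mul_pow]; norm_num
      _ ≤ (2/3) ^ k := pow_le_pow_of_le_one (by norm_num) (by norm_num) hkn
      _ = (2/9) ^ k * 3 ^ k := by rw [← mul_pow]; norm_num

/-- If `z_s^k` is the point of least generation in `Q`, the averages of `1_Q σ` over intervals
containing `x` are `≲ (2/9)^k 3^m`, where `m ≤ k` is maximal with `x ∈ I_s^m`. -/
lemma GoodPoints.div_le {δ : ℝ} (hδ : 0 < δ) (hδ1 : δ ≤ 1)
    {z : (k : ℕ) → (Fin k → Bool) → ℝ} (hz : GoodPoints δ z) {x : ℝ}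
    (hx : ∀ n, ∃ d : Fin n → Bool, x ∈ cantorI n d) {qa qb : ℝ} {k : ℕ} {s : ℕ → Bool}
    (hs : z k (fun i => s i) ∈ Icc qa qb)
    (hmin : ∀ l (e : Fin l → Bool), z l e ∈ Icc qa qb → k ≤ l)
    {a b : ℝ} (hxab : x ∈ Icc a b) :
    ((cantorSigma z).restrict (Icc qa qb) (Icc a b) / ENNReal.ofReal (b - a)) ^ 2 ≤
      ENNReal.ofReal (6 / δ) ^ 2 * ((2/9) ^ k) ^ 2 *
        ∑ m ∈ Finset.range (k + 1), (cantorI m fun i => s i).indicator (fun _ => 9 ^ m) x := by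
  rw [Measure.restrict_apply measurableSet_Icc, Icc_inter_Icc]
  rcases exists_minimal_point z (max a qa) (min b qb) with h | ⟨n, t, ht, htmin⟩
  · rw [cantorSigma_eq_zero h]
    simp
  have htJ : z n (fun i => t i) ∈ Icc a b := Icc_subset_Icc (le_max_left _ _) (min_le_left _ _) ht
  have htQ : z n (fun i => t i) ∈ Icc qa qb :=
    Icc_subset_Icc (le_max_right _ _) (min_le_right _ _) ht
  have hkn := hmin _ _ htQ
  have hst := hz.agree_of_minimal hδ hs hmin htQ
  obtain ⟨e, he⟩ := hx (n + 1)
  obtain ⟨m, hmn, hxm, hdist⟩ := hz.exists_common hδ hδ1 he t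
  have hlen : δ * (1/3) ^ (m + 1) ≤ b - a := hdist.trans <|
    abs_sub_le_iff.2 ⟨by linarith [hxab.2, htJ.1], by linarith [hxab.1, htJ.2]⟩
  have hxs : x ∈ cantorI (min m k) fun i => s i := by
    rw [cantorI_congr fun i hi => hst i (hi.trans_le (min_le_right _ _))]
    exact cantorI_subset (min_le_left _ _) t hxm
  have hpow : (2:ℝ≥0∞)/9 = ENNReal.ofReal (2/9) := by
    rw [ENNReal.ofReal_div_of_pos (by norm_num), ofReal_ofNat, ofReal_ofNat]
  have hquot : cantorSigma z (Icc (max a qa) (min b qb)) / ENNReal.ofReal (b - a) ≤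
      ENNReal.ofReal (6 / δ) * (2/9) ^ k * 3 ^ min m k := by
    calc _ ≤ 2 * (2/9) ^ n / ENNReal.ofReal (δ * (1/3) ^ (m + 1)) := by
          gcongr
          exact hz.cantorSigma_le hδ ht htmin
      _ = ENNReal.ofReal (6 / δ * ((2/9) ^ n * 3 ^ m)) := by
          rw [hpow, ← ofReal_ofNat 2, ← ofReal_pow (by norm_num), ← ofReal_mul (by norm_num),
            ← ofReal_div_of_pos (by positivity)]
          congr 1
          rw [one_div, inv_pow, pow_succ]
          field_simp
          norm_num
      _ ≤ ENNReal.ofReal (6 / δ * ((2/9) ^ k * 3 ^ min m k)) := by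
          exact ENNReal.ofReal_le_ofReal <|
            mul_le_mul_of_nonneg_left (two_ninths_pow_mul_le hkn hmn) (by positivity)
      _ = _ := by
          rw [hpow, ofReal_mul (by positivity), ofReal_mul (by positivity),
            ofReal_pow (by norm_num), ofReal_pow (by norm_num), ofReal_ofNat, mul_assoc]
  calc _ ≤ (ENNReal.ofReal (6 / δ) * (2/9) ^ k * 3 ^ min m k) ^ 2 := by gcongr
    _ = ENNReal.ofReal (6 / δ) ^ 2 * ((2/9) ^ k) ^ 2 *
        (cantorI (min m k) fun i => s i).indicator (fun _ => 9 ^ min m k) x := by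
      rw [indicator_of_mem hxs, mul_pow, mul_pow, ← pow_mul 3, mul_comm (min m k), pow_mul 3]
      norm_num
    _ ≤ _ := by
      gcongr
      exact Finset.single_le_sum
        (f := fun m => (cantorI m fun i => s i).indicator (fun _ => (9 : ℝ≥0∞) ^ m) x)
        (fun _ _ => zero_le) (Finset.mem_range.2 (Nat.lt_succ_of_le (min_le_right _ _)))

lemma sum_nine_halves_le (k : ℕ) :
    ∑ m ∈ Finset.range (k + 1), (9:ℝ≥0∞) ^ m * (1/2) ^ m ≤ 2 * (9/2) ^ k := by
  have h : (9:ℝ≥0∞) * (1/2) = 9/2 := by rw [mul_one_div]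
  simp only [← mul_pow, h]
  induction k with
  | zero => simp
  | succ k ih =>
    rw [Finset.sum_range_succ, two_mul]
    gcongr
    refine ih.trans ?_
    rw [pow_succ, mul_comm]
    gcongr
    rw [← ENNReal.toReal_le_toReal (by finiteness) (by finiteness)]
    simp only [toReal_div, toReal_ofNat]
    norm_num

/-- **Maximal function testing for the Cantor example.** With `ω` the Cantor measure,
`0 < δ < 1/2`, points `z_d^k ∈ G_d^k` at distance at least `δ|G_d^k|` from the endpoints
of `G_d^k`, and `σ = Σ_{k,d} (2/9)^k δ_{z_d^k}`, there is `C = C(δ)` such that for every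
bounded interval `Q`, `∫ M(1_Q σ)² dω ≤ C·σ(Q)`. -/
theorem cantor_maximal_testing (δ : ℝ) (hδ0 : 0 < δ) (hδ1 : δ < 1/2) :
    ∃ C : ℝ, 0 < C ∧
      ∀ ω : Measure ℝ, IsCantorMeasure ω →
      ∀ z : (k : ℕ) → (Fin k → Bool) → ℝ, GoodPoints δ z →
      ∀ qa qb : ℝ, qa ≤ qb →
        (∫⁻ x, maxFn ((cantorSigma z).restrict (Set.Icc qa qb)) x ^ 2 ∂ω)
          ≤ ENNReal.ofReal C * cantorSigma z (Set.Icc qa qb) := by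
  refine ⟨2 * (6 / δ) ^ 2, by positivity, fun ω hω z hz qa qb _ => ?_⟩
  rcases exists_minimal_point z qa qb with h | ⟨k, s, hs, hmin⟩
  · have : (cantorSigma z).restrict (Icc qa qb) = 0 :=
      Measure.restrict_eq_zero.2 (cantorSigma_eq_zero h)
    simp [this, maxFn]
  set S : ℝ → ℝ≥0∞ := fun x =>
    ∑ m ∈ Finset.range (k + 1), (cantorI m fun i => s i).indicator (fun _ => 9 ^ m) x with hS
  set c : ℝ≥0∞ := ENNReal.ofReal (6 / δ) ^ 2 * ((2/9) ^ k) ^ 2 with hc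
  have hmax : ∀ᵐ x ∂ω, maxFn ((cantorSigma z).restrict (Icc qa qb)) x ^ 2 ≤ c * S x := by
    filter_upwards [hz.ae_mem hδ0 hω] with x hx
    have : maxFn ((cantorSigma z).restrict (Icc qa qb)) x ≤ (c * S x) ^ (2⁻¹ : ℝ) := by
      refine iSup_le fun a => iSup_le fun b => iSup_le fun _ => iSup_le fun hxab => ?_
      rw [ENNReal.le_rpow_inv_iff two_pos, ENNReal.rpow_two]
      exact hz.div_le hδ0 (by linarith) hx hs hmin hxab
    rwa [ENNReal.le_rpow_inv_iff two_pos, ENNReal.rpow_two] at this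
  have hSint : ∫⁻ x, S x ∂ω ≤ 2 * (9/2) ^ k := by
    refine le_trans (le_of_eq ?_) (sum_nine_halves_le k)
    rw [hS, lintegral_finsetSum _ fun m _ => measurable_const.indicator (measurableSet_cantorI m _)]
    refine Finset.sum_congr rfl fun m _ => ?_
    rw [lintegral_indicator_const (measurableSet_cantorI m _), hω.2]
  have hSmeas : Measurable S :=
    Finset.measurable_fun_sum _ fun m _ => measurable_const.indicator (measurableSet_cantorI m _)
  have hcancel : ((2:ℝ≥0∞)/9) ^ k * (9/2) ^ k = 1 := by
    rw [← mul_pow]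
    have : (2:ℝ≥0∞)/9 * (9/2) = 1 := by
      rw [← ENNReal.toReal_eq_toReal_iff' (by finiteness) (by finiteness)]
      simp only [toReal_mul, toReal_div, toReal_ofNat, toReal_one]
      norm_num
    rw [this, one_pow]
  calc ∫⁻ x, maxFn ((cantorSigma z).restrict (Icc qa qb)) x ^ 2 ∂ω
      ≤ ∫⁻ x, c * S x ∂ω := lintegral_mono_ae hmax
    _ = c * ∫⁻ x, S x ∂ω := lintegral_const_mul _ hSmeas
    _ ≤ c * (2 * (9/2) ^ k) := by gcongr
    _ = 2 * ENNReal.ofReal (6 / δ) ^ 2 * (2/9) ^ k * ((2/9) ^ k * (9/2) ^ k) := by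
        rw [hc]; ring
    _ = ENNReal.ofReal (2 * (6 / δ) ^ 2) * (2/9) ^ k := by
        rw [hcancel, mul_one, ENNReal.ofReal_mul zero_le_two,
          ENNReal.ofReal_pow (by positivity), ENNReal.ofReal_ofNat]
    _ ≤ ENNReal.ofReal (2 * (6 / δ) ^ 2) * cantorSigma z (Icc qa qb) := by
        gcongr
        exact le_cantorSigma hs
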